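/- arXiv:1009.1292 — 4 statements merged into one kernel-verified Lean document; each statement's English description precedes it below -/
import Mathlib

section
/- Let 1 ≤ p < ∞, let (Ω, μ) be a σ-finite measure space, and let (U_t)_{t≥0} be a C₀-semigroup of linear isometries on L^p(μ). Then for every b ∈ L¹(ℝ) with support contained in [0,∞), ‖∫_0^∞ b(t) U_t dt‖_{L^p(μ)→L^p(μ)} ≤ ‖C_b‖_{L^p(ℝ)→L^p(ℝ)}. -/
open scoped ENNReal
open MeasureTheory

lemma aux_enorm {Ω : Type*} [MeasurableSpace Ω] {μ : Measure Ω} (p : ℝ≥0∞) [Fact (1 ≤ p)]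
    (hp : p ≠ ∞) (f : Lp ℂ p μ) : ‖f‖ₑ ^ p.toReal = ∫⁻ w, ‖f w‖ₑ ^ p.toReal ∂μ := by
  have h1 : (1:ℝ≥0∞) ≤ p := Fact.out
  have h0 : p ≠ 0 := (lt_of_lt_of_le one_pos h1).ne'
  rw [Lp.enorm_def, eLpNorm_eq_lintegral_rpow_enorm_toReal h0 hp, ← ENNReal.rpow_mul,
    one_div, inv_mul_cancel₀ (ENNReal.toReal_pos h0 hp).ne', ENNReal.rpow_one]

lemma aux_sum_coe {Ω : Type*} [MeasurableSpace Ω] {μ : Measure Ω} (p : ℝ≥0∞) [Fact (1 ≤ p)]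
    (m : ℕ) (c : ℕ → ℂ) (x : ℕ → Lp ℂ p μ) :
    ∀ᵐ w ∂μ, (∑ i ∈ Finset.range m, c i • x i : Lp ℂ p μ) w
      = ∑ i ∈ Finset.range m, c i * x i w := by
  induction m with
  | zero =>
    filter_upwards [Lp.coeFn_zero ℂ p μ] with w hw
    simpa using hw
  | succ m ih =>
    rw [Finset.sum_range_succ]
    filter_upwards [ih, Lp.coeFn_add (∑ i ∈ Finset.range m, c i • x i) (c m • x m),
      Lp.coeFn_smul (c m) (x m)] with w h1 h2 h3
    rw [h2, Pi.add_apply, h1, h3, Finset.sum_range_succ]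
    simp

lemma aux_sum_enorm {Ω : Type*} [MeasurableSpace Ω] {μ : Measure Ω} (p : ℝ≥0∞) [Fact (1 ≤ p)]
    (hp : p ≠ ∞) (m : ℕ) (c : ℕ → ℂ) (x : ℕ → Lp ℂ p μ) :
    ‖∑ i ∈ Finset.range m, c i • x i‖ₑ ^ p.toReal
      = ∫⁻ w, ‖∑ i ∈ Finset.range m, c i * x i w‖ₑ ^ p.toReal ∂μ := by
  rw [aux_enorm p hp]
  refine lintegral_congr_ae ?_
  filter_upwards [aux_sum_coe p m c x] with w hw
  rw [hw]

lemma aux_swap {α Ω : Type*} [MeasurableSpace α] [MeasurableSpace Ω] {ν : Measure α}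
    {μ : Measure Ω} [SigmaFinite ν] [SigmaFinite μ] (p : ℝ≥0∞) [Fact (1 ≤ p)]
    (hp : p ≠ ∞) (m : ℕ) (e : ℕ → Lp ℂ p ν) (x : ℕ → Lp ℂ p μ) :
    ∫⁻ s, ‖∑ i ∈ Finset.range m, (e i) s • x i‖ₑ ^ p.toReal ∂ν
      = ∫⁻ w, ‖∑ i ∈ Finset.range m, (x i) w • e i‖ₑ ^ p.toReal ∂μ := by
  simp_rw [aux_sum_enorm p hp]
  rw [lintegral_lintegral_swap]
  · simp_rw [mul_comm]
  · refine Measurable.aemeasurable ?_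
    refine Measurable.pow_const (Measurable.enorm ?_) _
    refine Finset.measurable_sum _ fun i _ => ?_
    exact ((Lp.stronglyMeasurable (e i)).measurable.comp measurable_fst).mul
      ((Lp.stronglyMeasurable (x i)).measurable.comp measurable_snd)

lemma aux_ext {α Ω : Type*} [MeasurableSpace α] [MeasurableSpace Ω] {ν : Measure α}
    {μ : Measure Ω} [SigmaFinite ν] [SigmaFinite μ] (p : ℝ≥0∞) [Fact (1 ≤ p)]
    (hp : p ≠ ∞) (T : Lp ℂ p ν →L[ℂ] Lp ℂ p ν) (m : ℕ) (e : ℕ → Lp ℂ p ν)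
    (x : ℕ → Lp ℂ p μ) :
    ∫⁻ s, ‖∑ i ∈ Finset.range m, (T (e i)) s • x i‖ₑ ^ p.toReal ∂ν
      ≤ ‖T‖ₑ ^ p.toReal *
        ∫⁻ s, ‖∑ i ∈ Finset.range m, (e i) s • x i‖ₑ ^ p.toReal ∂ν := by
  rw [aux_swap p hp m (fun i => T (e i)) x, aux_swap p hp m e x]
  rw [← lintegral_const_mul' _ _ (by finiteness)]
  refine lintegral_mono fun w => ?_
  have : ∑ i ∈ Finset.range m, (x i) w • T (e i) = T (∑ i ∈ Finset.range m, (x i) w • e i) := by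
    simp
  rw [this, ← ENNReal.mul_rpow_of_nonneg _ _ ENNReal.toReal_nonneg]
  gcongr
  exact T.le_opENorm _

section
/-- cells of the partition -/
def cell (δ : ℝ) (i : ℕ) : Set ℝ := {r | 0 ≤ -r ∧ ⌊(-r) / δ⌋₊ = i}

lemma cell_meas (δ : ℝ) (i : ℕ) : MeasurableSet (cell δ i) := by
  apply MeasurableSet.inter
  · exact measurableSet_le measurable_const measurable_neg
  · exact (Nat.measurable_floor.comp (measurable_neg.div_const δ)) (measurableSet_singleton i)

lemma cell_fin {δ : ℝ} (hδ : 0 < δ) (i : ℕ) : volume (cell δ i) ≠ ∞ := by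
  have : cell δ i ⊆ Set.Icc (-((i + 1) * δ)) 0 := by
    rintro r ⟨h1, h2⟩
    have := Nat.lt_floor_add_one ((-r) / δ)
    rw [h2, div_lt_iff₀ hδ] at this
    constructor <;> linarith
  exact (lt_of_le_of_lt (measure_mono this) (by simp)).ne

lemma cell_sum {E : Type*} [AddCommGroup E] [Module ℂ E] {δ : ℝ} (hδ : 0 < δ) (m : ℕ)
    (x : ℕ → E) (r : ℝ) :
    ∑ i ∈ Finset.range m, ((cell δ i).indicator (fun _ => (1:ℂ)) r) • x i
      = if 0 ≤ -r ∧ -r < m * δ then x ⌊(-r) / δ⌋₊ else 0 := by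
  by_cases h : 0 ≤ -r
  · have : ∀ i, ((cell δ i).indicator (fun _ => (1:ℂ)) r) • x i
        = if ⌊(-r) / δ⌋₊ = i then x i else 0 := by
      intro i
      by_cases hi : ⌊(-r) / δ⌋₊ = i <;> simp [Set.indicator, cell, h, hi] 
      rintro h' ; linarith
    simp_rw [this, Finset.sum_ite_eq, Finset.mem_range]
    have h3 : ⌊(-r) / δ⌋₊ < m ↔ -r < m * δ := by
      rw [Nat.floor_lt (by positivity), div_lt_iff₀ hδ]
    simp only [h3, h, true_and]
  · simp only [h, false_and, if_false]
    apply Finset.sum_eq_zero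
    intro i _
    simp [Set.indicator, cell]
    intro h'; exfalso; apply h; linarith
end

lemma aux_key (p : ℝ≥0∞) [Fact (1 ≤ p)] (hp : p ≠ ∞)
    {Ω : Type*} [MeasurableSpace Ω] {μ : Measure Ω} [SigmaFinite μ]
    (U : ℝ → (Lp ℂ p μ →L[ℂ] Lp ℂ p μ))
    (hUadd : ∀ s t : ℝ, 0 ≤ s → 0 ≤ t → U (s + t) = (U s).comp (U t))
    (hUn : ∀ t : ℝ, 0 ≤ t → ∀ y, ‖U t y‖ = ‖y‖)
    (hUcont : ∀ x : Lp ℂ p μ, ContinuousOn (fun t : ℝ => U t x) (Set.Ici 0))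
    (b : ℝ → ℂ) (hb : Integrable b (volume : Measure ℝ))
    (hbsupp : Function.support b ⊆ Set.Ici 0)
    (Cb : Lp ℂ p (volume : Measure ℝ) →L[ℂ] Lp ℂ p (volume : Measure ℝ))
    (hCb : ∀ f : Lp ℂ p (volume : Measure ℝ),
      ∀ᵐ s : ℝ, (Cb f : ℝ → ℂ) s = ∫ t : ℝ, b t * (f : ℝ → ℂ) (s - t))
    (A : Lp ℂ p μ →L[ℂ] Lp ℂ p μ)
    (hA : ∀ x : Lp ℂ p μ, A x = ∫ t in Set.Ici (0:ℝ), b t • U t x)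
    (x : Lp ℂ p μ) (ε δ R : ℝ) (hε : 0 < ε) (hδ : 0 < δ)
    (hδε : ∀ t, 0 ≤ t → t < δ → ‖x - U t x‖ ≤ ε) (m : ℕ) (c : ℝ)
    (hc : c = ‖A x‖ - (ε * (∫ t, ‖b t‖) + ‖x‖ * ∫ t in Set.Ici R, ‖b t‖)) :
    ENNReal.ofReal (m * δ - R) * ENNReal.ofReal c ^ p.toReal
      ≤ ‖Cb‖ₑ ^ p.toReal * (ENNReal.ofReal (m * δ) * ‖x‖ₑ ^ p.toReal) := by
  have h1 : (1:ℝ≥0∞) ≤ p := Fact.out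
  have h0 : p ≠ 0 := (lt_of_lt_of_le one_pos h1).ne'
  have hq : 0 < p.toReal := ENNReal.toReal_pos h0 hp
  set e : ℕ → Lp ℂ p (volume : Measure ℝ) := fun i =>
    indicatorConstLp p (cell_meas δ i) (cell_fin hδ i) (1:ℂ) with he
  set y : ℕ → Lp ℂ p μ := fun i => U (i * δ) x with hy
  set G : ℝ → Lp ℂ p μ := fun r =>
    if 0 ≤ -r ∧ -r < m * δ then y ⌊(-r) / δ⌋₊ else 0 with hG
  have heae : ∀ i, (e i : ℝ → ℂ) =ᵐ[volume] (cell δ i).indicator (fun _ => (1:ℂ)) :=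
    fun i => indicatorConstLp_coeFn
  have hyn : ∀ i, ‖y i‖ = ‖x‖ := fun i => hUn _ (by positivity) _
  have key := aux_ext p hp Cb m e y
  -- right-hand side
  have hR : ∫⁻ s, ‖∑ i ∈ Finset.range m, (e i) s • y i‖ₑ ^ p.toReal
      ≤ ENNReal.ofReal (m * δ) * ‖x‖ₑ ^ p.toReal := by
    have : ∀ᵐ s : ℝ, ‖∑ i ∈ Finset.range m, (e i) s • y i‖ₑ ^ p.toReal
        ≤ (Set.Ioc (-(m * δ)) 0).indicator (fun _ => ‖x‖ₑ ^ p.toReal) s := by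
      filter_upwards [ae_all_iff.2 heae] with s hs
      simp_rw [hs]
      rw [cell_sum hδ]
      split_ifs with h
      · rw [Set.indicator_of_mem (by constructor <;> linarith [h.1, h.2])]
        have : ‖y ⌊(-s) / δ⌋₊‖ₑ = ‖x‖ₑ := by
          rw [← ofReal_norm, ← ofReal_norm, hyn]
        rw [this]
      · simp [hq]
    refine (lintegral_mono_ae this).trans ?_
    rw [lintegral_indicator measurableSet_Ioc, setLIntegral_const, Real.volume_Ioc, mul_comm]
    simp
  -- left-hand side
  have hbU : Integrable (fun t => b t • U t x) := by
    rw [← integrableOn_iff_integrable_of_support_subset (s := Set.Ici 0)]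
    · have hm : AEStronglyMeasurable (fun t => b t • U t x) (volume.restrict (Set.Ici 0)) :=
        hb.1.restrict.smul ((hUcont x).aestronglyMeasurable measurableSet_Ici)
      refine Integrable.mono' ((hb.norm.mul_const ‖x‖).integrableOn (s := Set.Ici 0)) hm ?_
      filter_upwards [ae_restrict_mem measurableSet_Ici] with t ht
      rw [norm_smul, hUn t ht]
    · intro t ht
      apply hbsupp
      intro h
      apply ht
      simp [h]
  have hA' : A x = ∫ t, b t • U t x := by
    rw [hA]
    refine setIntegral_eq_integral_of_forall_compl_eq_zero fun t ht => ?_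
    have : b t = 0 := by
      by_contra h
      exact ht (hbsupp h)
    simp [this]
  have hint : ∀ (i : ℕ) (s : ℝ),
      Integrable (fun t => b t * (cell δ i).indicator (fun _ => (1:ℂ)) (s - t)) := by
    intro i s
    refine hb.mul_bdd (c := 1) ?_ ?_
    · exact ((measurable_const.indicator (cell_meas δ i)).comp
        (measurable_const.sub measurable_id)).aestronglyMeasurable
    · refine Filter.Eventually.of_forall fun t => ?_
      refine (norm_indicator_le_norm_self _ _).trans ?_
      simp
  have hGint : ∀ s : ℝ, (∫ t, b t • G (s - t)) = ∑ i ∈ Finset.range m,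
      (∫ t, b t * (cell δ i).indicator (fun _ => (1:ℂ)) (s - t)) • y i ∧
      Integrable (fun t => b t • G (s - t)) := by
    intro s
    have hE : (fun t => b t • G (s - t)) = fun t => ∑ i ∈ Finset.range m,
        (b t * (cell δ i).indicator (fun _ => (1:ℂ)) (s - t)) • y i := by
      funext t
      simp only [hG]
      rw [← cell_sum hδ m y (s - t), Finset.smul_sum]
      simp_rw [mul_smul]
    rw [hE]
    constructor
    · rw [integral_finset_sum _ (fun i _ => (hint i s).smul_const _)]
      refine Finset.sum_congr rfl fun i _ => ?_
      rw [integral_smul_const]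
    · exact integrable_finset_sum _ (fun i _ => (hint i s).smul_const _)
  have hV : ∀ᵐ s : ℝ, ∑ i ∈ Finset.range m, (Cb (e i)) s • y i = ∫ t, b t • G (s - t) := by
    filter_upwards [ae_all_iff.2 fun i => hCb (e i)] with s hs
    rw [(hGint s).1]
    refine Finset.sum_congr rfl fun i _ => ?_
    rw [hs i]
    congr 1
    refine integral_congr_ae ?_
    have hqm : Filter.Tendsto (fun t : ℝ => s - t) (ae volume) (ae volume) :=
      (Measure.measurePreserving_sub_left volume s).quasiMeasurePreserving.tendsto_ae
    filter_upwards [hqm.eventually (heae i)] with t ht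
    rw [ht]
  have hL : ∀ s, -(m * δ - R) < s → s ≤ 0 → c ≤ ‖∫ t, b t • G (s - t)‖ := by
    intro s hs1 hs2
    have hs0 : 0 ≤ -s := by linarith
    have hUA : U (-s) (A x) = ∫ t, b t • U (-s) (U t x) := by
      rw [hA', ← ContinuousLinearMap.integral_comp_comm _ hbU]
      simp
    have hUint : Integrable (fun t => b t • U (-s) (U t x)) := by
      simpa using (U (-s)).integrable_comp hbU
    have hd : ‖(∫ t, b t • G (s - t)) - U (-s) (A x)‖
        ≤ ε * (∫ t, ‖b t‖) + ‖x‖ * ∫ t in Set.Ici R, ‖b t‖ := by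
      rw [hUA, ← integral_sub (hGint s).2 hUint, ← integral_const_mul,
        ← integral_indicator measurableSet_Ici, ← integral_const_mul,
        ← integral_add (hb.norm.const_mul _)
          ((hb.norm.indicator measurableSet_Ici).const_mul _)]
      refine norm_integral_le_of_norm_le ((hb.norm.const_mul _).add
          ((hb.norm.indicator measurableSet_Ici).const_mul _)) ?_
      refine Filter.Eventually.of_forall fun t => ?_
      rw [← smul_sub, norm_smul]
      have hind : 0 ≤ (Set.Ici R).indicator (fun a => ‖b a‖) t :=
        Set.indicator_nonneg (fun _ _ => norm_nonneg _) _
      by_cases ht : 0 ≤ t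
      · have hts : 0 ≤ -(s - t) := by linarith
        have hUU : U (-s) (U t x) = U (-(s - t)) x := by
          rw [show -(s - t) = -s + t by ring, hUadd _ _ hs0 ht]; rfl
        rw [hUU]
        by_cases htN : -(s - t) < m * δ
        · have hGv : G (s - t) = y ⌊(-(s - t)) / δ⌋₊ := by
            simp only [hG]; rw [if_pos ⟨hts, htN⟩]
          have hk1 := Nat.floor_le (div_nonneg hts hδ.le)
          have hk2 := Nat.lt_floor_add_one ((-(s - t)) / δ)
          rw [hGv]
          set k := ⌊(-(s - t)) / δ⌋₊
          rw [le_div_iff₀ hδ] at hk1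
          rw [div_lt_iff₀ hδ] at hk2
          have hk0 : (0:ℝ) ≤ k * δ := by positivity
          have : U (-(s - t)) x = U (k * δ) (U (-(s - t) - k * δ) x) := by
            conv_lhs => rw [show -(s - t) = k * δ + (-(s - t) - k * δ) by ring,
              hUadd _ _ hk0 (by linarith)]
            rfl
          have h5 : ‖y k - U (-(s - t)) x‖ ≤ ε := by
            rw [this]
            simp only [hy]
            rw [← map_sub, hUn _ hk0]
            exact hδε _ (by linarith) (by linarith)
          have := mul_le_mul_of_nonneg_left h5 (norm_nonneg (b t))
          have := mul_nonneg (norm_nonneg x) hind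
          linarith
        · have hGv : G (s - t) = 0 := by
            simp only [hG]; rw [if_neg (fun h => htN h.2)]
          rw [hGv, zero_sub, norm_neg, hUn _ hts,
            Set.indicator_of_mem (show t ∈ Set.Ici R by simp only [Set.mem_Ici]; linarith)]
          have := mul_nonneg hε.le (norm_nonneg (b t))
          linarith
      · have : b t = 0 := by
          by_contra h
          exact ht (hbsupp h)
        rw [this, norm_zero, zero_mul, mul_zero, zero_add]
        exact mul_nonneg (norm_nonneg _) hind
    have h6 := norm_sub_norm_le (U (-s) (A x)) (∫ t, b t • G (s - t))
    rw [norm_sub_rev, hUn _ hs0] at h6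
    linarith
  have hLL : ENNReal.ofReal (m * δ - R) * ENNReal.ofReal c ^ p.toReal
      ≤ ∫⁻ s, ‖∑ i ∈ Finset.range m, (Cb (e i)) s • y i‖ₑ ^ p.toReal := by
    have : ∀ᵐ s : ℝ, (Set.Ioc (-(m * δ - R)) 0).indicator
        (fun _ => ENNReal.ofReal c ^ p.toReal) s
        ≤ ‖∑ i ∈ Finset.range m, (Cb (e i)) s • y i‖ₑ ^ p.toReal := by
      filter_upwards [hV] with s hs
      rw [hs]
      by_cases h : s ∈ Set.Ioc (-(m * δ - R)) 0
      · rw [Set.indicator_of_mem h, ← ofReal_norm]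
        exact ENNReal.rpow_le_rpow (ENNReal.ofReal_le_ofReal (hL s h.1 h.2)) hq.le
      · rw [Set.indicator_of_notMem h]; exact zero_le
    refine le_trans (le_of_eq ?_) (lintegral_mono_ae this)
    rw [lintegral_indicator measurableSet_Ioc, setLIntegral_const, Real.volume_Ioc, mul_comm]
    simp
  refine hLL.trans (key.trans ?_)
  gcongr

/-- Let `1 ≤ p < ∞`, let `(Ω, μ)` be a σ-finite measure space and let
`(U_t)_{t≥0}` be a `C₀`-semigroup of linear isometries on `L^p(μ)`.  Then for every
`b ∈ L¹(ℝ)` with support contained in `[0,∞)`,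
`‖∫_0^∞ b(t) U_t dt‖ ≤ ‖C_b‖_{L^p(ℝ)→L^p(ℝ)}`. -/
theorem semigroup_isometries_convolution_bound (p : ℝ≥0∞) [Fact (1 ≤ p)] (hp : p ≠ ∞)
    (Ω : Type*) [MeasurableSpace Ω] (μ : Measure Ω) [SigmaFinite μ]
    (U : ℝ → (Lp ℂ p μ →L[ℂ] Lp ℂ p μ))
    (hU0 : U 0 = 1)
    (hUadd : ∀ s t : ℝ, 0 ≤ s → 0 ≤ t → U (s + t) = (U s).comp (U t))
    (hUiso : ∀ t : ℝ, 0 ≤ t → Isometry (U t))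
    (hUcont : ∀ x : Lp ℂ p μ, ContinuousOn (fun t : ℝ => U t x) (Set.Ici 0))
    (b : ℝ → ℂ) (hb : Integrable b (volume : Measure ℝ))
    (hbsupp : Function.support b ⊆ Set.Ici 0)
    (Cb : Lp ℂ p (volume : Measure ℝ) →L[ℂ] Lp ℂ p (volume : Measure ℝ))
    (hCb : ∀ f : Lp ℂ p (volume : Measure ℝ),
      ∀ᵐ s : ℝ, (Cb f : ℝ → ℂ) s = ∫ t : ℝ, b t * (f : ℝ → ℂ) (s - t))
    (A : Lp ℂ p μ →L[ℂ] Lp ℂ p μ)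
    (hA : ∀ x : Lp ℂ p μ, A x = ∫ t in Set.Ici (0:ℝ), b t • U t x) :
    ‖A‖ ≤ ‖Cb‖ := by
  have h1 : (1:ℝ≥0∞) ≤ p := Fact.out
  have h0 : p ≠ 0 := (lt_of_lt_of_le one_pos h1).ne'
  have hq : 0 < p.toReal := ENNReal.toReal_pos h0 hp
  have hUn : ∀ t : ℝ, 0 ≤ t → ∀ y, ‖U t y‖ = ‖y‖ := fun t ht y =>
    (hUiso t ht).norm_map_of_map_zero (map_zero _) y
  refine ContinuousLinearMap.opNorm_le_bound _ (norm_nonneg _) fun x => ?_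
  set B := ∫ t, ‖b t‖ with hB
  have hB0 : 0 ≤ B := integral_nonneg fun _ => norm_nonneg _
  have main : ∀ ε : ℝ, 0 < ε → ‖A x‖ - ε * (B + ‖x‖) ≤ ‖Cb‖ * ‖x‖ := by
    intro ε hε
    obtain ⟨δ, hδ, hδε⟩ : ∃ δ > 0, ∀ t, 0 ≤ t → t < δ → ‖x - U t x‖ ≤ ε := by
      obtain ⟨δ, hδ, h⟩ := Metric.continuousWithinAt_iff.1 (hUcont x 0 Set.self_mem_Ici) ε hε
      refine ⟨δ, hδ, fun t ht0 ht => ?_⟩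
      have := h (x := t) ht0 (by rw [Real.dist_eq, sub_zero, abs_of_nonneg ht0]; exact ht)
      rw [dist_eq_norm, hU0, norm_sub_rev] at this
      exact this.le
    obtain ⟨R, hR⟩ : ∃ R : ℝ, ∫ t in Set.Ici R, ‖b t‖ ≤ ε := by
      have ht := tendsto_setIntegral_of_antitone (μ := volume) (f := fun t => ‖b t‖)
        (s := fun R : ℝ => Set.Ici R) (fun _ => measurableSet_Ici)
        (fun a b h => Set.Ici_subset_Ici.2 h) ⟨0, hb.norm.integrableOn⟩
      have hem : ⋂ n : ℝ, Set.Ici n = (∅ : Set ℝ) := by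
        ext z
        simp only [Set.mem_iInter, Set.mem_Ici, Set.mem_empty_iff_false, iff_false, not_forall,
          not_le]
        exact ⟨z + 1, by linarith⟩
      rw [hem] at ht
      simp only [Measure.restrict_empty, integral_zero_measure] at ht
      exact (ht.eventually (ge_mem_nhds hε)).exists
    set c := ‖A x‖ - (ε * B + ‖x‖ * ∫ t in Set.Ici R, ‖b t‖) with hc
    have hcx : ‖A x‖ - ε * (B + ‖x‖) ≤ c := by
      have := mul_le_mul_of_nonneg_left hR (norm_nonneg x)
      rw [hc]; linarith
    refine hcx.trans ?_
    have hK0 : 0 ≤ ‖Cb‖ * ‖x‖ := by positivity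
    rcases le_or_gt c 0 with hc0 | hc0
    · exact hc0.trans hK0
    have hm : ∀ m : ℕ, (m * δ - R) * c ^ p.toReal ≤ (m * δ) * (‖Cb‖ * ‖x‖) ^ p.toReal := by
      intro m
      have h := aux_key p hp U hUadd hUn hUcont b hb hbsupp Cb hCb A hA x ε δ R hε hδ hδε m c hc
      have hmδ : 0 ≤ m * δ := by positivity
      rw [← ofReal_norm, ← ofReal_norm, ENNReal.ofReal_rpow_of_pos hc0,
        ENNReal.ofReal_rpow_of_nonneg (norm_nonneg _) hq.le,
        ENNReal.ofReal_rpow_of_nonneg (norm_nonneg _) hq.le,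
        ← ENNReal.ofReal_mul' (by positivity), ← ENNReal.ofReal_mul hmδ,
        ← ENNReal.ofReal_mul (by positivity), ENNReal.ofReal_le_ofReal_iff (by positivity)] at h
      rw [Real.mul_rpow (norm_nonneg _) (norm_nonneg _)]
      linarith
    rw [← Real.rpow_le_rpow_iff hc0.le hK0 hq]
    by_contra hcon
    push Not at hcon
    obtain ⟨m, hm'⟩ := exists_nat_gt
      (R * c ^ p.toReal / (δ * (c ^ p.toReal - (‖Cb‖ * ‖x‖) ^ p.toReal)))
    rw [div_lt_iff₀ (mul_pos hδ (sub_pos.2 hcon))] at hm'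
    have := hm m
    nlinarith
  have hlim : Filter.Tendsto (fun ε : ℝ => ‖A x‖ - ε * (B + ‖x‖)) (nhdsWithin 0 (Set.Ioi 0))
      (nhds (‖A x‖ - 0 * (B + ‖x‖))) := by
    refine Filter.Tendsto.mono_left ?_ nhdsWithin_le_nhds
    exact (Continuous.tendsto (by fun_prop) 0)
  rw [zero_mul, sub_zero] at hlim
  exact le_of_tendsto hlim (by filter_upwards [self_mem_nhdsWithin] with ε hε using main ε hε)
end

section
/- Let 1 ≤ p < ∞ and let (Ω, μ) and (Ω', ν) be σ-finite measure spaces. Let (T_t)_{t≥0} be a C₀-semigroup of contractions on L^p(μ), and suppose there exist a linear isometry J : L^p(μ) → L^p(ν), a C₀-semigroup of linear isometries (U_t)_{t≥0} on L^p(ν), and a bounded linear map Q : L^p(ν) → L^p(μ) with ‖Q‖ ≤ 1, such that T_t = Q ∘ U_t ∘ J for every t ≥ 0. Then for every b ∈ L¹(ℝ) with support contained in [0,∞), ‖∫_0^∞ b(t) T_t dt‖_{L^p(μ)→L^p(μ)} ≤ ‖C_b‖_{L^p(ℝ)→L^p(ℝ)}. -/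
open scoped ENNReal
open MeasureTheory

lemma aux_enorm_rpow {α : Type*} [MeasurableSpace α] {μ : Measure α} {p : ℝ≥0∞} [Fact (1 ≤ p)]
    (hp : p ≠ ∞) (z : Lp ℂ p μ) :
    ‖z‖ₑ ^ p.toReal = ∫⁻ a, ‖(z : α → ℂ) a‖ₑ ^ p.toReal ∂μ := by
  have h1 : (1 : ℝ≥0∞) ≤ p := Fact.out
  have h0 : p ≠ 0 := (lt_of_lt_of_le one_pos h1).ne'
  have hq : p.toReal ≠ 0 := (ENNReal.toReal_pos h0 hp).ne'
  rw [Lp.enorm_def, eLpNorm_eq_lintegral_rpow_enorm_toReal h0 hp, ← ENNReal.rpow_mul]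
  simp [hq]

lemma aux_coe_sum {α ι : Type*} [MeasurableSpace α] {μ : Measure α} {p : ℝ≥0∞} [Fact (1 ≤ p)]
    (s : Finset ι) (c : ι → ℂ) (y : ι → Lp ℂ p μ) :
    ∀ᵐ a ∂μ, ((∑ i ∈ s, c i • y i : Lp ℂ p μ) : α → ℂ) a = ∑ i ∈ s, c i * (y i : α → ℂ) a := by
  classical
  induction s using Finset.induction_on with
  | empty => 
    filter_upwards [Lp.coeFn_zero ℂ p μ] with a ha
    simpa using ha
  | insert i s hi ih =>
    filter_upwards [ih, Lp.coeFn_add (c i • y i) (∑ i ∈ s, c i • y i),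
      Lp.coeFn_smul (c i) (y i)] with a h1 h2 h3
    rw [Finset.sum_insert hi, Finset.sum_insert hi, h2, Pi.add_apply, h1, h3]
    simp

lemma aux_fubini {α β ι : Type*} [MeasurableSpace α] [MeasurableSpace β]
    {μ : Measure α} {ν : Measure β} [SFinite μ] [SFinite ν] {p : ℝ≥0∞} [Fact (1 ≤ p)]
    (hp : p ≠ ∞) (s : Finset ι) (ψ : ι → Lp ℂ p μ) (y : ι → Lp ℂ p ν) :
    ∫⁻ a, ‖∑ i ∈ s, (ψ i : α → ℂ) a • y i‖ₑ ^ p.toReal ∂μ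
      = ∫⁻ w, ‖∑ i ∈ s, (y i : β → ℂ) w • ψ i‖ₑ ^ p.toReal ∂ν := by
  have e1 : ∀ a, ‖∑ i ∈ s, (ψ i : α → ℂ) a • y i‖ₑ ^ p.toReal
      = ∫⁻ w, ‖∑ i ∈ s, (ψ i : α → ℂ) a * (y i : β → ℂ) w‖ₑ ^ p.toReal ∂ν := by
    intro a
    rw [aux_enorm_rpow hp]
    refine lintegral_congr_ae ?_
    filter_upwards [aux_coe_sum s (fun i => (ψ i : α → ℂ) a) y] with w hw
    rw [hw]
  have e2 : ∀ w, ‖∑ i ∈ s, (y i : β → ℂ) w • ψ i‖ₑ ^ p.toReal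
      = ∫⁻ a, ‖∑ i ∈ s, (ψ i : α → ℂ) a * (y i : β → ℂ) w‖ₑ ^ p.toReal ∂μ := by
    intro w
    rw [aux_enorm_rpow hp]
    refine lintegral_congr_ae ?_
    filter_upwards [aux_coe_sum s (fun i => (y i : β → ℂ) w) ψ] with a ha
    rw [ha]
    simp only [mul_comm]
  simp only [e1, e2]
  refine lintegral_lintegral_swap ?_
  have m1 : ∀ i, Measurable (ψ i : α → ℂ) := fun i => (Lp.stronglyMeasurable _).measurable
  have m2 : ∀ i, Measurable (y i : β → ℂ) := fun i => (Lp.stronglyMeasurable _).measurable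
  refine Measurable.aemeasurable ?_
  unfold Function.uncurry
  refine Measurable.pow_const (Measurable.enorm ?_) _
  refine Finset.measurable_sum _ fun i _ => ?_
  exact ((m1 i).comp measurable_fst).mul ((m2 i).comp measurable_snd)

lemma aux_key_s16 {α β ι : Type*} [MeasurableSpace α] [MeasurableSpace β]
    {μ : Measure α} {ν : Measure β} [SFinite μ] [SFinite ν] {p : ℝ≥0∞} [Fact (1 ≤ p)]
    (hp : p ≠ ∞) (C : Lp ℂ p μ →L[ℂ] Lp ℂ p μ) (s : Finset ι) (φ : ι → Lp ℂ p μ)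
    (y : ι → Lp ℂ p ν) :
    ∫⁻ a, ‖∑ i ∈ s, (C (φ i) : α → ℂ) a • y i‖ₑ ^ p.toReal ∂μ
      ≤ ‖C‖ₑ ^ p.toReal * ∫⁻ a, ‖∑ i ∈ s, (φ i : α → ℂ) a • y i‖ₑ ^ p.toReal ∂μ := by
  rw [aux_fubini hp s (fun i => C (φ i)) y, aux_fubini hp s φ y, ← lintegral_const_mul']
  · refine lintegral_mono fun w => ?_
    have : ∑ i ∈ s, (y i : β → ℂ) w • C (φ i) = C (∑ i ∈ s, (y i : β → ℂ) w • φ i) := by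
      simp [map_sum]
    simp only [this]
    rw [← ENNReal.mul_rpow_of_nonneg _ _ ENNReal.toReal_nonneg]
    exact ENNReal.rpow_le_rpow (C.le_opENorm _) ENNReal.toReal_nonneg
  · exact ENNReal.rpow_ne_top_of_nonneg ENNReal.toReal_nonneg enorm_ne_top

lemma aux_step {E : Type*} [NormedAddCommGroup E] [NormedSpace ℂ E] (c : ℕ → E) {δ : ℝ}
    (hδ : 0 < δ) (M : ℕ) (r : ℝ) :
    ∑ k ∈ Finset.range M, (Set.Ico (k * δ) ((k + 1) * δ)).indicator (fun _ => (1 : ℂ)) r • c k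
      = (Set.Ico 0 (M * δ)).indicator (fun r => c ⌊r / δ⌋₊) r := by
  induction M with
  | zero => simp
  | succ M ih =>
    rw [Finset.sum_range_succ, ih]
    have hM : (0 : ℝ) ≤ M * δ := by positivity
    have hM' : ((M + 1 : ℕ) : ℝ) * δ = M * δ + δ := by push_cast; ring
    have hM'' : ((M : ℝ) + 1) * δ = M * δ + δ := by ring
    rw [hM', hM'']
    by_cases h1 : r < M * δ
    · have h2 : r < M * δ + δ := by linarith
      simp [Set.indicator, h1, h2, not_le.2 h1]
    · by_cases h3 : r < M * δ + δ
      · have h4 : ⌊r / δ⌋₊ = M := by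
          rw [Nat.floor_eq_iff (div_nonneg (hM.trans (not_lt.1 h1)) hδ.le)]
          constructor
          · rw [le_div_iff₀ hδ]; exact not_lt.1 h1
          · rw [div_lt_iff₀ hδ]; linarith
        simp [Set.indicator, h1, h3, not_lt.1 h1, hM.trans (not_lt.1 h1), h4]
      · simp [Set.indicator, h1, h3]

lemma aux_arch {a c : ℝ} (m : ℕ) (h : ∀ n : ℕ, n * a ≤ (n + m) * c) : a ≤ c := by
  by_contra hac
  push Not at hac
  obtain ⟨n, hn⟩ := exists_nat_gt (m * c / (a - c))
  rw [div_lt_iff₀ (by linarith)] at hn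
  have := h n
  nlinarith

lemma aux_tail {b : ℝ → ℂ} (hb : Integrable b) {δ ε : ℝ} (hδ : 0 < δ) (hε : 0 < ε) :
    ∃ m : ℕ, ∫ t in Set.Ici (m * δ), ‖b t‖ < ε := by
  have h := tendsto_setIntegral_of_antitone (μ := volume) (f := fun t => ‖b t‖)
    (s := fun m : ℕ => Set.Ici (m * δ)) (fun _ => measurableSet_Ici)
    (fun i j hij => Set.Ici_subset_Ici.2 (by gcongr)) ⟨0, hb.norm.integrableOn⟩
  have he : ⋂ m : ℕ, Set.Ici (m * δ) = ∅ := by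
    ext r
    simp only [Set.mem_iInter, Set.mem_Ici, Set.mem_empty_iff_false, iff_false, not_forall, not_le]
    obtain ⟨n, hn⟩ := exists_nat_gt (r / δ)
    exact ⟨n, (div_lt_iff₀ hδ).1 hn⟩
  rw [he] at h
  simp only [Measure.restrict_empty, integral_zero_measure] at h
  exact (h.eventually (gt_mem_nhds hε)).exists

/-- Bound of the difference between the discretised and the true orbit integral. -/
lemma aux_diff {E : Type*} [NormedAddCommGroup E] [NormedSpace ℂ E] [CompleteSpace E]
    (U : ℝ → (E →L[ℂ] E))
    (hUadd : ∀ s t : ℝ, 0 ≤ s → 0 ≤ t → U (s + t) = (U s).comp (U t))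
    (hUiso : ∀ t : ℝ, 0 ≤ t → Isometry (U t))
    (hUcont : ∀ x : E, ContinuousOn (fun t : ℝ => U t x) (Set.Ici 0))
    (b : ℝ → ℂ) (hb : Integrable b (volume : Measure ℝ))
    (hbsupp : Function.support b ⊆ Set.Ici 0) (x : E) {δ ε : ℝ} (hδ : 0 < δ) (hε : 0 < ε)
    (hx : ∀ u, 0 ≤ u → u < δ → ‖U u x - x‖ ≤ ε) (m n : ℕ)
    (hm : ∫ t in Set.Ici (m * δ), ‖b t‖ < ε) (s : ℝ) (hs : s ∈ Set.Ico 0 (n * δ)) :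
    ‖∫ t in Set.Ici (0:ℝ), b t • U t x‖ - ε * ((∫ t, ‖b t‖) + 2 * ‖x‖) ≤
    ‖∑ k ∈ Finset.range (n + m), (∫ t, b t *
      (Set.Ico (k * δ) ((k + 1) * δ)).indicator (fun _ => (1 : ℂ)) (t + s)) • U (k * δ) x‖ := by
  have hnorm : ∀ t, 0 ≤ t → ∀ z, ‖U t z‖ = ‖z‖ := fun t ht z =>
    (AddMonoidHomClass.isometry_iff_norm (U t)).1 (hUiso t ht) z
  have hs0 : 0 ≤ s := hs.1
  set g : ℝ → E := fun r => (Set.Ico 0 ((n + m : ℕ) * δ)).indicator (fun r => U (⌊r / δ⌋₊ * δ) x) r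
    with hg
  have hint : ∀ k : ℕ, Integrable (fun t => b t *
      (Set.Ico (k * δ) ((k + 1) * δ)).indicator (fun _ => (1 : ℂ)) (t + s)) := by
    intro k
    have : (fun t => b t *
      (Set.Ico (k * δ) ((k + 1) * δ)).indicator (fun _ => (1 : ℂ)) (t + s)) =
      ((fun t => t + s) ⁻¹' (Set.Ico (k * δ) ((k + 1) * δ))).indicator b := by
      ext t
      simp only [Set.indicator, Set.mem_preimage]
      split_ifs <;> simp
    rw [this]
    exact hb.indicator ((measurable_add_const s) measurableSet_Ico)
  have hsum : ∀ t, ∑ k ∈ Finset.range (n + m), (b t *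
      (Set.Ico (k * δ) ((k + 1) * δ)).indicator (fun _ => (1 : ℂ)) (t + s)) • U (k * δ) x
      = b t • g (t + s) := by
    intro t
    simp only [hg]
    rw [← aux_step (fun k => U (k * δ) x) hδ (n + m) (t + s), Finset.smul_sum]
    simp only [mul_smul]
  have e1 : ∑ k ∈ Finset.range (n + m), (∫ t, b t *
      (Set.Ico (k * δ) ((k + 1) * δ)).indicator (fun _ => (1 : ℂ)) (t + s)) • U (k * δ) x
      = ∫ t, b t • g (t + s) := by
    simp only [← integral_smul_const]
    rw [← integral_finsetSum _ fun k _ => (hint k).smul_const _]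
    simp only [hsum]
  have hgi : Integrable (fun t => b t • g (t + s)) := by
    simp only [← hsum]
    exact integrable_finsetSum _ fun k _ => (hint k).smul_const _
  have e2 : ∫ t, b t • g (t + s) = ∫ t in Set.Ici (0:ℝ), b t • g (t + s) := by
    symm
    refine setIntegral_eq_integral_of_forall_compl_eq_zero fun t ht => ?_
    have : b t = 0 := by
      by_contra h
      exact ht (hbsupp h)
    simp [this]
  have hUi : ∀ z : E, IntegrableOn (fun t => b t • U t z) (Set.Ici 0) := by
    intro z
    refine Integrable.mono' ((hb.norm.mul_const ‖z‖).integrableOn) ?_ ?_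
    · exact hb.aestronglyMeasurable.restrict.smul
        ((hUcont z).aestronglyMeasurable measurableSet_Ici)
    · refine (ae_restrict_iff' measurableSet_Ici).2 (Filter.Eventually.of_forall fun t ht => ?_)
      rw [norm_smul, hnorm t ht]
  have e3 : U s (∫ t in Set.Ici (0:ℝ), b t • U t x)
      = ∫ t in Set.Ici (0:ℝ), b t • U t (U s x) := by
    rw [← ContinuousLinearMap.integral_comp_comm _ (hUi x)]
    refine setIntegral_congr_fun measurableSet_Ici fun t ht => ?_
    have h1 := hUadd s t hs0 ht
    have h2 := hUadd t s ht hs0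
    rw [add_comm] at h2
    have := congrArg (fun V : E →L[ℂ] E => V x) (h1.symm.trans h2)
    simp only [ContinuousLinearMap.comp_apply] at this
    simp [this]
  have hpt : ∀ t, 0 ≤ t → ‖b t • U t (U s x) - b t • g (t + s)‖
      ≤ ε * ‖b t‖ + 2 * ‖x‖ * (Set.Ici (m * δ)).indicator (fun t => ‖b t‖) t := by
    intro t ht
    have hts : 0 ≤ t + s := by linarith
    rw [← smul_sub, norm_smul]
    have hUU : U t (U s x) = U (t + s) x := by rw [hUadd t s ht hs0]; rfl
    rw [hUU]
    have hfl : 0 ≤ (⌊(t + s) / δ⌋₊ : ℝ) * δ := by positivity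
    have hgn : ‖g (t + s)‖ ≤ ‖x‖ := by
      simp only [hg]
      by_cases h : t + s ∈ Set.Ico 0 ((n + m : ℕ) * δ)
      · rw [Set.indicator_of_mem h, hnorm _ hfl]
      · rw [Set.indicator_of_notMem h]; simp
    by_cases hR : t < m * δ
    · have h : t + s ∈ Set.Ico 0 ((n + m : ℕ) * δ) := by
        refine ⟨hts, ?_⟩
        push_cast
        nlinarith [hs.2]
      rw [Set.indicator_of_notMem (by simpa using hR)]
      have : ‖U (t + s) x - g (t + s)‖ ≤ ε := by
        simp only [hg]
        rw [Set.indicator_of_mem h]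
        set r := t + s
        have h1 : (⌊r / δ⌋₊ : ℝ) * δ ≤ r := by
          rw [← le_div_iff₀ hδ]; exact Nat.floor_le (by positivity)
        have h2 : r < (⌊r / δ⌋₊ : ℝ) * δ + δ := by
          have := Nat.lt_floor_add_one (r / δ)
          rw [div_lt_iff₀ hδ] at this
          linarith
        set q := (⌊r / δ⌋₊ : ℝ) * δ
        have h3 : U r = (U q).comp (U (r - q)) := by
          rw [← hUadd q (r - q) hfl (by linarith)]; congr 1; ring
        rw [h3, ContinuousLinearMap.comp_apply, ← map_sub, hnorm _ hfl]
        exact hx _ (by linarith) (by linarith)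
      nlinarith [norm_nonneg (b t)]
    · rw [Set.indicator_of_mem (by simpa using hR)]
      have : ‖U (t + s) x - g (t + s)‖ ≤ 2 * ‖x‖ := by
        refine (norm_sub_le _ _).trans ?_
        rw [hnorm _ hts]; linarith
      nlinarith [norm_nonneg (b t), mul_nonneg hε.le (norm_nonneg (b t))]
  have hd : ‖(∫ t in Set.Ici (0:ℝ), b t • U t (U s x)) - ∫ t in Set.Ici (0:ℝ), b t • g (t + s)‖
      ≤ ε * ((∫ t, ‖b t‖) + 2 * ‖x‖) := by
    rw [← integral_sub (hUi _) hgi.integrableOn]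
    have hi1 : Integrable (fun t => ε * ‖b t‖) := hb.norm.const_mul _
    have hi2 : Integrable (fun t =>
        2 * ‖x‖ * (Set.Ici (m * δ)).indicator (fun t => ‖b t‖) t) :=
      (hb.norm.indicator measurableSet_Ici).const_mul _
    refine (norm_integral_le_of_norm_le (hi1.add hi2).integrableOn
      ((ae_restrict_iff' measurableSet_Ici).2 (Filter.Eventually.of_forall hpt))).trans ?_
    refine (setIntegral_le_integral (hi1.add hi2) (Filter.Eventually.of_forall fun t => ?_)).trans ?_
    · have : 0 ≤ (Set.Ici (m * δ)).indicator (fun t => ‖b t‖) t :=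
        Set.indicator_nonneg (fun _ _ => norm_nonneg _) _
      simp only [Pi.zero_apply, Pi.add_apply]
      positivity
    · simp only [Pi.add_apply]
      rw [integral_add hi1 hi2, integral_const_mul, integral_const_mul,
        integral_indicator measurableSet_Ici]
      nlinarith [norm_nonneg x]
  rw [e1, e2]
  rw [← e3] at hd
  have := norm_sub_norm_le (U s (∫ t in Set.Ici (0:ℝ), b t • U t x))
    (∫ t in Set.Ici (0:ℝ), b t • g (t + s))
  rw [hnorm s hs0] at this
  linarith

lemma aux_iso_bound {p : ℝ≥0∞} [Fact (1 ≤ p)] (hp : p ≠ ∞)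
    {Ω' : Type*} [MeasurableSpace Ω'] {ν : Measure Ω'} [SigmaFinite ν]
    (U : ℝ → (Lp ℂ p ν →L[ℂ] Lp ℂ p ν))
    (hU0 : U 0 = 1)
    (hUadd : ∀ s t : ℝ, 0 ≤ s → 0 ≤ t → U (s + t) = (U s).comp (U t))
    (hUiso : ∀ t : ℝ, 0 ≤ t → Isometry (U t))
    (hUcont : ∀ x : Lp ℂ p ν, ContinuousOn (fun t : ℝ => U t x) (Set.Ici 0))
    (b : ℝ → ℂ) (hb : Integrable b (volume : Measure ℝ))
    (hbsupp : Function.support b ⊆ Set.Ici 0)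
    (Cb : Lp ℂ p (volume : Measure ℝ) →L[ℂ] Lp ℂ p (volume : Measure ℝ))
    (hCb : ∀ f : Lp ℂ p (volume : Measure ℝ),
      ∀ᵐ s : ℝ, (Cb f : ℝ → ℂ) s = ∫ t : ℝ, b t * (f : ℝ → ℂ) (s - t))
    (x : Lp ℂ p ν) :
    ‖∫ t in Set.Ici (0:ℝ), b t • U t x‖ ≤ ‖Cb‖ * ‖x‖ := by
  have hq : 0 < p.toReal :=
    ENNReal.toReal_pos (lt_of_lt_of_le one_pos (Fact.out : (1 : ℝ≥0∞) ≤ p)).ne' hp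
  have hnorm : ∀ t, 0 ≤ t → ∀ z, ‖U t z‖ = ‖z‖ := fun t ht z =>
    (AddMonoidHomClass.isometry_iff_norm (U t)).1 (hUiso t ht) z
  have hK : 0 < (∫ t, ‖b t‖) + 2 * ‖x‖ + 1 := by
    have : 0 ≤ ∫ t, ‖b t‖ := integral_nonneg fun _ => norm_nonneg _
    positivity
  refine le_of_forall_pos_le_add fun ε' hε' => ?_
  obtain ⟨ε, hε, hεK⟩ : ∃ ε > 0, ε * ((∫ t, ‖b t‖) + 2 * ‖x‖) ≤ ε' := by
    refine ⟨ε' / ((∫ t, ‖b t‖) + 2 * ‖x‖ + 1), by positivity, ?_⟩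
    rw [div_mul_eq_mul_div, div_le_iff₀ hK]
    nlinarith
  obtain ⟨δ, hδ, hδx⟩ : ∃ δ > 0, ∀ u, 0 ≤ u → u < δ → ‖U u x - x‖ ≤ ε := by
    have := Metric.continuousWithinAt_iff.1 (hUcont x 0 Set.self_mem_Ici) ε hε
    obtain ⟨δ, hδ, h⟩ := this
    refine ⟨δ, hδ, fun u hu hu' => ?_⟩
    have := h (x := u) hu (by simpa [abs_of_nonneg hu] using hu')
    rw [dist_eq_norm] at this
    simpa [hU0] using this.le
  obtain ⟨m, hm⟩ := aux_tail hb hδ hε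
  set β := ‖∫ t in Set.Ici (0:ℝ), b t • U t x‖ with hβ
  by_cases hd : β - ε' ≤ 0
  · have : 0 ≤ ‖Cb‖ * ‖x‖ := by positivity
    linarith
  push Not at hd
  suffices h : (β - ε') ^ p.toReal ≤ (‖Cb‖ * ‖x‖) ^ p.toReal by
    have := (Real.rpow_le_rpow_iff hd.le (by positivity) hq).1 h
    linarith
  refine aux_arch m fun n => ?_
  -- the building blocks
  let I : ℕ → Set ℝ := fun k => Set.Ico (k * δ) ((k + 1) * δ)
  let S : ℕ → Set ℝ := fun k => Neg.neg ⁻¹' (I k)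
  have hS : ∀ k, MeasurableSet (S k) := fun k => measurable_neg measurableSet_Ico
  have hSf : ∀ k, volume (S k) ≠ ∞ := fun k => by
    simp only [S, I, Measure.measure_preimage_neg]
    simp
  let φ : ℕ → Lp ℂ p (volume : Measure ℝ) := fun k => indicatorConstLp p (hS k) (hSf k) 1
  have hφ : ∀ k, ∀ᵐ a, (φ k : ℝ → ℂ) a = (I k).indicator (fun _ => (1 : ℂ)) (-a) := by
    intro k
    filter_upwards [indicatorConstLp_coeFn (p := p) (hs := hS k) (hμs := hSf k) (c := (1:ℂ))]
      with a ha
    simp only [φ, ha]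
    rfl
  have hkey := aux_key_s16 hp Cb (Finset.range (n + m)) φ (fun k => U (k * δ) x)
  have hup : ∫⁻ a, ‖∑ k ∈ Finset.range (n + m), (φ k : ℝ → ℂ) a • U (k * δ) x‖ₑ ^ p.toReal
      ≤ ENNReal.ofReal ((n + m) * δ) * ‖x‖ₑ ^ p.toReal := by
    have hall : ∀ᵐ a, ∀ k, (φ k : ℝ → ℂ) a = (I k).indicator (fun _ => (1 : ℂ)) (-a) :=
      ae_all_iff.2 hφ
    calc _ ≤ ∫⁻ a, (Neg.neg ⁻¹' (Set.Ico 0 ((n + m : ℕ) * δ))).indicator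
          (fun _ => ‖x‖ₑ ^ p.toReal) a := by
          refine lintegral_mono_ae ?_
          filter_upwards [hall] with a ha
          simp only [ha, I]
          rw [aux_step (fun k => U (k * δ) x) hδ (n + m) (-a)]
          by_cases h : -a ∈ Set.Ico 0 ((n + m : ℕ) * δ)
          · rw [Set.indicator_of_mem h, Set.indicator_of_mem (by exact h)]
            refine ENNReal.rpow_le_rpow (le_of_eq ?_) hq.le
            rw [enorm_eq_iff_norm_eq]
            exact hnorm _ (by positivity) x
          · rw [Set.indicator_of_notMem h]
            simp [hq]
      _ = _ := by
          rw [lintegral_indicator_const (measurable_neg measurableSet_Ico),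
            Measure.measure_preimage_neg, Real.volume_Ico, mul_comm]
          simp
  have hlow : ENNReal.ofReal (n * δ) * ENNReal.ofReal (β - ε') ^ p.toReal ≤
      ∫⁻ a, ‖∑ k ∈ Finset.range (n + m), (Cb (φ k) : ℝ → ℂ) a • U (k * δ) x‖ₑ ^ p.toReal := by
    have hall : ∀ᵐ a, ∀ k, (Cb (φ k) : ℝ → ℂ) a = ∫ t : ℝ, b t * (φ k : ℝ → ℂ) (a - t) :=
      ae_all_iff.2 fun k => hCb _
    calc _ = ∫⁻ a, (Neg.neg ⁻¹' (Set.Ico 0 (n * δ))).indicator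
          (fun _ => ENNReal.ofReal (β - ε') ^ p.toReal) a := by
          rw [lintegral_indicator_const (measurable_neg measurableSet_Ico),
            Measure.measure_preimage_neg, Real.volume_Ico, mul_comm]
          simp
      _ ≤ _ := by
          refine lintegral_mono_ae ?_
          filter_upwards [hall] with a ha
          by_cases h : -a ∈ Set.Ico 0 (n * δ)
          · rw [Set.indicator_of_mem (by exact h)]
            refine ENNReal.rpow_le_rpow ?_ hq.le
            rw [← ofReal_norm]
            refine ENNReal.ofReal_le_ofReal ?_
            have h2 := aux_diff U hUadd hUiso hUcont b hb hbsupp x hδ hε hδx m n hm (-a) h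
            have h3 : ∀ k : ℕ, (Cb (φ k) : ℝ → ℂ) a = ∫ t, b t *
                (Set.Ico (k * δ) ((k + 1) * δ)).indicator (fun _ => (1 : ℂ)) (t + -a) := by
              intro k
              rw [ha k]
              refine integral_congr_ae ?_
              have hqm := (Measure.measurePreserving_sub_left
                (volume : Measure ℝ) a).quasiMeasurePreserving.ae (hφ k)
              filter_upwards [hqm] with t ht
              rw [ht, neg_sub, sub_eq_add_neg]
            simp only [h3]
            exact le_trans (sub_le_sub_left hεK β) h2
          · rw [Set.indicator_of_notMem (by exact h)]
            exact zero_le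
  have hfin := hlow.trans (hkey.trans (mul_le_mul_right hup _))
  have hnn : (0:ℝ) ≤ n * δ := by positivity
  have hnm : (0:ℝ) ≤ (n + m) * δ := by positivity
  rw [ENNReal.ofReal_rpow_of_nonneg hd.le hq.le, ← ENNReal.ofReal_mul hnn, ← ofReal_norm Cb,
    ← ofReal_norm x, ENNReal.ofReal_rpow_of_nonneg (norm_nonneg _) hq.le,
    ENNReal.ofReal_rpow_of_nonneg (norm_nonneg _) hq.le, ← ENNReal.ofReal_mul hnm,
    ← ENNReal.ofReal_mul (by positivity), ENNReal.ofReal_le_ofReal_iff (by positivity)] at hfin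
  rw [Real.mul_rpow (norm_nonneg _) (norm_nonneg _)]
  refine le_of_mul_le_mul_left ?_ hδ
  linarith

/-- Let `1 ≤ p < ∞`, let `(Ω, μ)` and `(Ω', ν)` be σ-finite measure
spaces and let `(T_t)_{t≥0}` be a `C₀`-semigroup of contractions on `L^p(μ)` admitting a
dilation `T_t = Q ∘ U_t ∘ J` by a `C₀`-semigroup of isometries `(U_t)_{t≥0}` on `L^p(ν)`,
where `J : L^p(μ) → L^p(ν)` is a linear isometry and `Q : L^p(ν) → L^p(μ)` is a
contraction.  Then for every `b ∈ L¹(ℝ)` with support contained in `[0,∞)`,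
`‖∫_0^∞ b(t) T_t dt‖ ≤ ‖C_b‖_{L^p(ℝ)→L^p(ℝ)}`. -/
theorem dilated_semigroup_convolution_bound (p : ℝ≥0∞) [Fact (1 ≤ p)] (hp : p ≠ ∞)
    (Ω : Type*) [MeasurableSpace Ω] (μ : Measure Ω) [SigmaFinite μ]
    (Ω' : Type*) [MeasurableSpace Ω'] (ν : Measure Ω') [SigmaFinite ν]
    (T : ℝ → (Lp ℂ p μ →L[ℂ] Lp ℂ p μ))
    (hT0 : T 0 = 1)
    (hTadd : ∀ s t : ℝ, 0 ≤ s → 0 ≤ t → T (s + t) = (T s).comp (T t))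
    (hTcontr : ∀ t : ℝ, 0 ≤ t → ‖T t‖ ≤ 1)
    (hTcont : ∀ x : Lp ℂ p μ, ContinuousOn (fun t : ℝ => T t x) (Set.Ici 0))
    (J : Lp ℂ p μ →L[ℂ] Lp ℂ p ν) (hJ : Isometry J)
    (U : ℝ → (Lp ℂ p ν →L[ℂ] Lp ℂ p ν))
    (hU0 : U 0 = 1)
    (hUadd : ∀ s t : ℝ, 0 ≤ s → 0 ≤ t → U (s + t) = (U s).comp (U t))
    (hUiso : ∀ t : ℝ, 0 ≤ t → Isometry (U t))
    (hUcont : ∀ x : Lp ℂ p ν, ContinuousOn (fun t : ℝ => U t x) (Set.Ici 0))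
    (Q : Lp ℂ p ν →L[ℂ] Lp ℂ p μ) (hQ : ‖Q‖ ≤ 1)
    (hdil : ∀ t : ℝ, 0 ≤ t → T t = (Q.comp (U t)).comp J)
    (b : ℝ → ℂ) (hb : Integrable b (volume : Measure ℝ))
    (hbsupp : Function.support b ⊆ Set.Ici 0)
    (Cb : Lp ℂ p (volume : Measure ℝ) →L[ℂ] Lp ℂ p (volume : Measure ℝ))
    (hCb : ∀ f : Lp ℂ p (volume : Measure ℝ),
      ∀ᵐ s : ℝ, (Cb f : ℝ → ℂ) s = ∫ t : ℝ, b t * (f : ℝ → ℂ) (s - t))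
    (A : Lp ℂ p μ →L[ℂ] Lp ℂ p μ)
    (hA : ∀ x : Lp ℂ p μ, A x = ∫ t in Set.Ici (0:ℝ), b t • T t x) :
    ‖A‖ ≤ ‖Cb‖ := by

  refine ContinuousLinearMap.opNorm_le_bound _ (norm_nonneg _) fun x => ?_
  have hJn : ‖J x‖ = ‖x‖ := (AddMonoidHomClass.isometry_iff_norm J).1 hJ x
  have hUi : IntegrableOn (fun t => b t • U t (J x)) (Set.Ici 0) := by
    refine Integrable.mono' ((hb.norm.mul_const ‖J x‖).integrableOn) ?_ ?_
    · exact hb.aestronglyMeasurable.restrict.smul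
        ((hUcont (J x)).aestronglyMeasurable measurableSet_Ici)
    · refine (ae_restrict_iff' measurableSet_Ici).2 (Filter.Eventually.of_forall fun t ht => ?_)
      rw [norm_smul, (AddMonoidHomClass.isometry_iff_norm (U t)).1 (hUiso t ht)]
  have e : A x = Q (∫ t in Set.Ici (0:ℝ), b t • U t (J x)) := by
    rw [hA, ← ContinuousLinearMap.integral_comp_comm _ hUi]
    refine setIntegral_congr_fun measurableSet_Ici fun t ht => ?_
    simp [hdil t ht]
  have h := aux_iso_bound hp U hU0 hUadd hUiso hUcont b hb hbsupp Cb hCb (J x)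
  rw [hJn] at h
  rw [e]
  refine (Q.le_of_opNorm_le hQ _).trans ?_
  rwa [one_mul]
end

section
/- Let I be an index set and let A : I × I → ℝ. The following are equivalent: (i) for every t > 0 and every finite subset F ⊆ I, the matrix [exp(−t·A(i,j))]_{i,j∈F} is positive semidefinite, and A(i,i) = 0 for every i ∈ I; (ii) there exist a real inner product space H and a family (α_i)_{i∈I} in H such that A(i,j) = ‖α_i − α_j‖² for all i, j ∈ I. -/
universe u

open Filter Topology in
lemma schoen_neg {I : Type u} (A : I → I → ℝ) (F : Finset I)
    (h : ∀ t : ℝ, 0 < t → ∀ x : I → ℝ,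
      0 ≤ ∑ i ∈ F, ∑ j ∈ F, x i * Real.exp (-t * A i j) * x j)
    (x : I → ℝ) (hx : ∑ i ∈ F, x i = 0) :
    ∑ i ∈ F, ∑ j ∈ F, x i * A i j * x j ≤ 0 := by
  have hd : HasDerivAt (fun t : ℝ => ∑ i ∈ F, ∑ j ∈ F, x i * Real.exp (-t * A i j) * x j)
      (∑ i ∈ F, ∑ j ∈ F, -(x i * A i j * x j)) 0 := by
    refine HasDerivAt.fun_sum fun i _ => HasDerivAt.fun_sum fun j _ => ?_
    have h1 : HasDerivAt (fun t : ℝ => -t * A i j) (-1 * A i j) 0 :=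
      ((hasDerivAt_id (0:ℝ)).neg).mul_const _
    have h2 := (h1.exp.const_mul (x i)).mul_const (x j)
    have e : x i * (Real.exp (-(0:ℝ) * A i j) * (-1 * A i j)) * x j = -(x i * A i j * x j) := by
      simp
    rw [← e]
    exact h2
  have h0 : ∑ i ∈ F, ∑ j ∈ F, x i * Real.exp (-(0:ℝ) * A i j) * x j = 0 := by
    simp [← Finset.mul_sum, hx]
  have ht := hd.tendsto_slope_zero_right
  have : 0 ≤ ∑ i ∈ F, ∑ j ∈ F, -(x i * A i j * x j) := by
    refine ge_of_tendsto ht ?_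
    filter_upwards [self_mem_nhdsWithin] with t ht
    have ht' : 0 < t := ht
    rw [h0, zero_add, sub_zero, smul_eq_mul]
    exact mul_nonneg (inv_nonneg.2 ht'.le) (h t ht' x)
  simp only [Finset.sum_neg_distrib] at this
  linarith

lemma schoen_base {I : Type u} (A : I → I → ℝ) (hs : ∀ i j, A i j = A j i)
    (h0 : ∀ i, A i i = 0)
    (h : ∀ (F : Finset I) (x : I → ℝ), ∑ i ∈ F, x i = 0 →
      ∑ i ∈ F, ∑ j ∈ F, x i * A i j * x j ≤ 0) (o : I) (v : I →₀ ℝ) :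
    0 ≤ ∑ i ∈ v.support, ∑ j ∈ v.support, v i * (A i o + A o j - A i j) * v j := by
  classical
  set F := insert o v.support with hF
  have hsub : v.support ⊆ F := Finset.subset_insert _ _
  have e1 : ∑ i ∈ v.support, ∑ j ∈ v.support, v i * (A i o + A o j - A i j) * v j
      = ∑ i ∈ F, ∑ j ∈ F, v i * (A i o + A o j - A i j) * v j := by
    rw [Finset.sum_subset hsub]
    · refine Finset.sum_congr rfl fun i _ => ?_
      refine Finset.sum_subset hsub fun j _ hj => ?_
      simp [Finsupp.notMem_support_iff.1 hj]
    · intro i _ hi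
      simp [Finsupp.notMem_support_iff.1 hi]
  set x : I → ℝ := fun i => v i - if i = o then ∑ k ∈ F, v k else 0 with hx
  have hx0 : ∑ i ∈ F, x i = 0 := by
    simp [hx, Finset.sum_sub_distrib, hF]
  have e2 : ∑ i ∈ F, ∑ j ∈ F, v i * (A i o + A o j - A i j) * v j
      = ∑ i ∈ F, ∑ j ∈ F, x i * (A i o + A o j - A i j) * x j := by
    refine Finset.sum_congr rfl fun i _ => Finset.sum_congr rfl fun j _ => ?_
    by_cases hi : i = o
    · subst hi; simp [h0]
    · by_cases hj : j = o
      · subst hj; simp [h0]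
      · simp [hx, hi, hj]
  have e3 : ∑ i ∈ F, ∑ j ∈ F, x i * (A i o + A o j - A i j) * x j
      = (∑ i ∈ F, x i * A i o) * (∑ j ∈ F, x j) + (∑ i ∈ F, x i) * (∑ j ∈ F, A o j * x j)
        - ∑ i ∈ F, ∑ j ∈ F, x i * A i j * x j := by
    rw [Finset.sum_mul_sum, Finset.sum_mul_sum, ← Finset.sum_add_distrib,
      ← Finset.sum_sub_distrib]
    refine Finset.sum_congr rfl fun i _ => ?_
    rw [← Finset.sum_add_distrib, ← Finset.sum_sub_distrib]
    exact Finset.sum_congr rfl fun j _ => by ring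
  rw [e1, e2, e3, hx0]
  have := h F x hx0
  linarith

lemma schoen_embed {I : Type u} (k : I → I → ℝ) (hs : ∀ i j, k i j = k j i)
    (h : ∀ v : I →₀ ℝ, 0 ≤ ∑ i ∈ v.support, ∑ j ∈ v.support, v i * k i j * v j) :
    ∃ (H : Type u) (_ : NormedAddCommGroup H) (_ : InnerProductSpace ℝ H) (α : I → H),
      ∀ i j : I, inner ℝ (α i) (α j) = k i j := by
  let K : Matrix I I (ℝ →L[ℝ] ℝ) := .of fun i j => k i j • ContinuousLinearMap.id ℝ ℝ
  have hK : K.PosSemidef := by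
    have tf := (RKHS.posSemidef_tfae (K := K)).out 0 2
    rw [tf]
    refine ⟨?_, fun v => ?_⟩
    · ext i j
      have e : ContinuousLinearMap.adjoint (ContinuousLinearMap.id ℝ ℝ)
          = ContinuousLinearMap.id ℝ ℝ := by
        rw [← ContinuousLinearMap.star_eq_adjoint]
        exact star_one (ℝ →L[ℝ] ℝ)
      simp [K, hs i j, ContinuousLinearMap.star_eq_adjoint, e]
    · refine (h v).trans_eq ?_
      simp only [Finsupp.sum, K]
      simp
      refine Finset.sum_congr rfl fun i _ => Finset.sum_congr rfl fun j _ => ?_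
      rw [hs i j]; ring
  have : Fact K.PosSemidef := ⟨hK⟩
  refine ⟨RKHS.OfKernel K, inferInstance, inferInstance,
    fun i => RKHS.kerFun (RKHS.OfKernel K) i (1:ℝ), fun i j => ?_⟩
  rw [← RKHS.kernel_inner, RKHS.OfKernel.kernel_ofKernel]
  simp [K, hs i j]

lemma schoen_pow {H : Type u} [NormedAddCommGroup H] [InnerProductSpace ℝ H] {J : Type u}
    [Fintype J] (α : J → H) (n : ℕ) :
    (Matrix.of fun i j => (inner ℝ (α i) (α j)) ^ n : Matrix J J ℝ).PosSemidef := by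
  induction n with
  | zero =>
    have := Matrix.posSemidef_gram ℝ (fun _ : J => (1:ℝ))
    have e : (Matrix.of fun i j => (inner ℝ (α i) (α j)) ^ 0 : Matrix J J ℝ) =
        Matrix.gram ℝ (fun _ : J => (1:ℝ)) := by
      ext i j
      simp
    rw [e]
    exact this
  | succ n ih =>
    have := ih.hadamard (Matrix.posSemidef_gram ℝ α)
    exact this

lemma schoen_exp {I : Type u} {H : Type u} [NormedAddCommGroup H] [InnerProductSpace ℝ H]
    (α : I → H) (F : Finset I) (t : ℝ) (ht : 0 < t) (x : I → ℝ) :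
    0 ≤ ∑ i ∈ F, ∑ j ∈ F, x i * Real.exp (-t * ‖α i - α j‖ ^ 2) * x j := by
  set y : I → ℝ := fun i => x i * Real.exp (-t * ‖α i‖ ^ 2) with hy
  have hsum : HasSum (fun n : ℕ => ∑ i ∈ F, ∑ j ∈ F,
      y i * ((2 * t * inner ℝ (α i) (α j)) ^ n / n.factorial) * y j)
      (∑ i ∈ F, ∑ j ∈ F, x i * Real.exp (-t * ‖α i - α j‖ ^ 2) * x j) := by
    refine hasSum_sum fun i _ => hasSum_sum fun j _ => ?_
    have h1 := NormedSpace.exp_series_hasSum_exp' (𝕂 := ℝ) (2 * t * inner ℝ (α i) (α j))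
    rw [← Real.exp_eq_exp_ℝ] at h1
    have h2 := (h1.mul_left (y i)).mul_right (y j)
    have e1 : (fun n : ℕ => y i * ((2 * t * inner ℝ (α i) (α j)) ^ n / n.factorial) * y j) =
        fun n : ℕ => y i * ((n.factorial : ℝ)⁻¹ • (2 * t * inner ℝ (α i) (α j)) ^ n) * y j := by
      ext n; simp only [smul_eq_mul]; ring
    have e2 : x i * Real.exp (-t * ‖α i - α j‖ ^ 2) * x j =
        y i * Real.exp (2 * t * inner ℝ (α i) (α j)) * y j := by
      have : Real.exp (-t * ‖α i - α j‖ ^ 2) = Real.exp (-t * ‖α i‖ ^ 2) *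
          Real.exp (2 * t * inner ℝ (α i) (α j)) * Real.exp (-t * ‖α j‖ ^ 2) := by
        rw [← Real.exp_add, ← Real.exp_add, norm_sub_sq_real]
        congr 1; ring
      rw [this, hy]; ring
    rw [e1, e2]
    exact h2
  refine hsum.nonneg fun n => ?_
  have hp := (schoen_pow (fun i : F => α i) n).dotProduct_mulVec_nonneg (fun i : F => y i)
  have : ∑ i ∈ F, ∑ j ∈ F, y i * ((2 * t * inner ℝ (α i) (α j)) ^ n / n.factorial) * y j
      = ((2 * t) ^ n / n.factorial) *
        ∑ i ∈ F, ∑ j ∈ F, y i * (inner ℝ (α i) (α j) ^ n * y j) := by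
    simp only [Finset.mul_sum]
    refine Finset.sum_congr rfl fun i _ => Finset.sum_congr rfl fun j _ => ?_
    rw [mul_pow]; ring
  rw [this]
  refine mul_nonneg (by positivity) (hp.trans_eq ?_)
  simp only [dotProduct, Matrix.mulVec, Matrix.of_apply, Pi.star_apply, star_trivial,
    Finset.mul_sum]
  rw [← Finset.sum_coe_sort F]
  refine Finset.sum_congr rfl fun i _ => ?_
  rw [← Finset.sum_coe_sort F]



/-- Schoenberg.  Let `I` be an index set and `A : I × I → ℝ`.  The
following are equivalent: (i) for every `t > 0` and every finite `F ⊆ I` the matrix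
`[exp(−t·A(i,j))]_{i,j∈F}` is positive semidefinite (symmetric, with nonnegative
quadratic form), and `A(i,i) = 0` for every `i`; (ii) there exist a real inner product
space `H` and a family `(α_i)_{i∈I}` in `H` with `A(i,j) = ‖α_i − α_j‖²` for all `i, j`. -/
theorem schoenberg_negative_definite_kernel {I : Type u} (A : I → I → ℝ) :
    ((∀ t : ℝ, 0 < t → ∀ F : Finset I,
        (∀ i ∈ F, ∀ j ∈ F, Real.exp (-t * A i j) = Real.exp (-t * A j i)) ∧
        (∀ x : I → ℝ, 0 ≤ ∑ i ∈ F, ∑ j ∈ F, x i * Real.exp (-t * A i j) * x j)) ∧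
      (∀ i : I, A i i = 0)) ↔
    (∃ (H : Type u) (_ : NormedAddCommGroup H) (_ : InnerProductSpace ℝ H) (α : I → H),
      ∀ i j : I, A i j = ‖α i - α j‖ ^ 2) := by
  constructor
  · rintro ⟨h, h0⟩
    have hs : ∀ i j, A i j = A j i := by
      classical
      intro i j
      have := Real.exp_injective ((h 1 one_pos {i, j}).1 i (by simp) j (by simp))
      linarith
    have hneg := fun F => schoen_neg A F (fun t ht => (h t ht F).2)
    rcases isEmpty_or_nonempty I with hI | ⟨⟨o⟩⟩
    · obtain ⟨H, i1, i2, α, -⟩ := schoen_embed (fun _ _ : I => 0) (fun _ _ => rfl) (by simp)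
      exact ⟨H, i1, i2, α, fun i => hI.elim i⟩
    · obtain ⟨H, i1, i2, α, hα⟩ := schoen_embed (fun i j => (A i o + A o j - A i j) / 2)
        (fun i j => by rw [hs i o, hs o j, hs i j]; ring) (fun v => by
          have := div_nonneg (schoen_base A hs h0 hneg o v) (zero_le_two (α := ℝ))
          refine this.trans_eq ?_
          simp only [Finset.sum_div]
          exact Finset.sum_congr rfl fun i _ => Finset.sum_congr rfl fun j _ => by ring)
      refine ⟨H, i1, i2, α, fun i j => ?_⟩
      rw [norm_sub_sq_real, ← real_inner_self_eq_norm_sq, ← real_inner_self_eq_norm_sq,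
        hα, hα, hα, h0, h0, hs o i, hs o j]
      ring
  · rintro ⟨H, _, _, α, hα⟩
    refine ⟨fun t ht F => ⟨fun i _ j _ => ?_, fun x => ?_⟩, fun i => by simp [hα]⟩
    · rw [hα, hα, norm_sub_rev]
    · simp only [hα]
      exact schoen_exp α F t ht x
end

section
/- Let 1 ≤ p < ∞ and let (Ω, μ) and (Ω', ν) be σ-finite measure spaces. Let T : L^p(μ) → L^p(μ) be a bounded linear map, and suppose there exist a linear isometry J : L^p(μ) → L^p(ν), a linear isometry U : L^p(ν) → L^p(ν), and a bounded linear map Q : L^p(ν) → L^p(μ) with ‖Q‖ ≤ 1, such that T^k = Q ∘ U^k ∘ J for every integer k ≥ 0. Then for every complex polynomial P, ‖P(T)‖_{L^p(μ)→L^p(μ)} ≤ ‖P(S)‖_{ℓ^p(ℕ)→ℓ^p(ℕ)}. -/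
open scoped ENNReal
open MeasureTheory

lemma shift_pow_apply {p : ℝ≥0∞} [Fact (1 ≤ p)]
    (S : lp (fun _ : ℕ => ℂ) p →L[ℂ] lp (fun _ : ℕ => ℂ) p)
    (hS : ∀ (x : lp (fun _ : ℕ => ℂ) p) (j : ℕ),
      (S x : ∀ _ : ℕ, ℂ) j = if j = 0 then 0 else (x : ∀ _ : ℕ, ℂ) (j - 1))
    (k : ℕ) (x : lp (fun _ : ℕ => ℂ) p) (j : ℕ) :
    ((S ^ k) x : ∀ _ : ℕ, ℂ) j = if j < k then 0 else (x : ∀ _ : ℕ, ℂ) (j - k) := by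
  induction k generalizing j with
  | zero => simp
  | succ k ih =>
    rw [pow_succ', ContinuousLinearMap.mul_apply, hS, ih]
    by_cases h0 : j = 0
    · simp [h0]
    · have e : j - 1 - k = j - (k + 1) := by omega
      have e2 : (j - 1 < k) ↔ (j < k + 1) := by omega
      simp only [h0, if_false, e, e2]

lemma shift_finite_bound {p : ℝ≥0∞} [Fact (1 ≤ p)] (hp : p ≠ ∞)
    (S : lp (fun _ : ℕ => ℂ) p →L[ℂ] lp (fun _ : ℕ => ℂ) p)
    (hS : ∀ (x : lp (fun _ : ℕ => ℂ) p) (j : ℕ),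
      (S x : ∀ _ : ℕ, ℂ) j = if j = 0 then 0 else (x : ∀ _ : ℕ, ℂ) (j - 1))
    (P : Polynomial ℂ) (y : ℕ → ℂ) (N : ℕ) :
    ∑ j ∈ Finset.range N,
      ‖∑ k ∈ Finset.range (P.natDegree + 1), P.coeff k * y (j + k)‖ ^ p.toReal
      ≤ ‖Polynomial.aeval S P‖ ^ p.toReal *
        ∑ m ∈ Finset.range (N + P.natDegree + 1), ‖y m‖ ^ p.toReal := by
  have hq : 0 < p.toReal :=
    ENNReal.toReal_pos (zero_lt_one.trans_le Fact.out).ne' hp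
  set n := P.natDegree with hn
  set M := N + n with hM
  let w : ℕ → ℂ := fun i => y (M - i)
  let z : lp (fun _ : ℕ => ℂ) p :=
    ∑ i ∈ Finset.range (M + 1), lp.single (E := fun _ : ℕ => ℂ) p i (w i)
  have hz : ‖z‖ ^ p.toReal = ∑ m ∈ Finset.range (M + 1), ‖y m‖ ^ p.toReal := by
    have h := lp.norm_sum_single (E := fun _ : ℕ => ℂ) hq w (Finset.range (M + 1))
    rw [show ‖z‖ ^ p.toReal = _ from h]
    have := Finset.sum_range_reflect (fun m => ‖y m‖ ^ p.toReal) (M + 1)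
    rw [← this]
    apply Finset.sum_congr rfl
    intro i hi
    simp [w]
  have hzi : ∀ i, i ≤ M → (z : ∀ _ : ℕ, ℂ) i = y (M - i) := by
    intro i hi
    simp only [z, lp.coeFn_sum, lp.coeFn_single, Finset.sum_apply, Finset.sum_pi_single]
    simp [w, Nat.lt_succ_of_le hi]
  have happ : ∀ j ∈ Finset.range N, ((Polynomial.aeval S P) z : ∀ _ : ℕ, ℂ) (M - j)
      = ∑ k ∈ Finset.range (n + 1), P.coeff k * y (j + k) := by
    intro j hj
    rw [Finset.mem_range] at hj
    rw [Polynomial.aeval_eq_sum_range]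
    simp only [ContinuousLinearMap.sum_apply, lp.coeFn_sum, Finset.sum_apply,
      ContinuousLinearMap.smul_apply, lp.coeFn_smul, Pi.smul_apply, smul_eq_mul]
    apply Finset.sum_congr rfl
    intro k hk
    rw [Finset.mem_range] at hk
    rw [shift_pow_apply S hS, if_neg (by omega), hzi _ (by omega)]
    congr 2
    omega
  have hinj : Set.InjOn (fun j => M - j) (Finset.range N : Set ℕ) := by
    intro a ha b hb hab
    simp only [Finset.coe_range, Set.mem_Iio] at ha hb
    dsimp only at hab
    omega
  calc _ = ∑ j ∈ Finset.range N,
        ‖((Polynomial.aeval S P) z : ∀ _ : ℕ, ℂ) (M - j)‖ ^ p.toReal :=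
        Finset.sum_congr rfl fun j hj => by rw [happ j hj]
    _ = ∑ i ∈ (Finset.range N).image (fun j => M - j),
        ‖((Polynomial.aeval S P) z : ∀ _ : ℕ, ℂ) i‖ ^ p.toReal := by
        rw [Finset.sum_image hinj]
    _ ≤ ‖(Polynomial.aeval S P) z‖ ^ p.toReal := lp.sum_rpow_le_norm_rpow hq _ _
    _ ≤ (‖Polynomial.aeval S P‖ * ‖z‖) ^ p.toReal := by
        gcongr
        exact ContinuousLinearMap.le_opNorm _ _
    _ = _ := by
        rw [Real.mul_rpow (norm_nonneg _) (norm_nonneg _), hz]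

lemma shift_finite_bound_enorm {p : ℝ≥0∞} [Fact (1 ≤ p)] (hp : p ≠ ∞)
    (S : lp (fun _ : ℕ => ℂ) p →L[ℂ] lp (fun _ : ℕ => ℂ) p)
    (hS : ∀ (x : lp (fun _ : ℕ => ℂ) p) (j : ℕ),
      (S x : ∀ _ : ℕ, ℂ) j = if j = 0 then 0 else (x : ∀ _ : ℕ, ℂ) (j - 1))
    (P : Polynomial ℂ) (y : ℕ → ℂ) (N : ℕ) :
    ∑ j ∈ Finset.range N,
      ‖∑ k ∈ Finset.range (P.natDegree + 1), P.coeff k * y (j + k)‖ₑ ^ p.toReal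
      ≤ ‖Polynomial.aeval S P‖ₑ ^ p.toReal *
        ∑ m ∈ Finset.range (N + P.natDegree + 1), ‖y m‖ₑ ^ p.toReal := by
  have h := ENNReal.ofReal_le_ofReal (shift_finite_bound hp S hS P y N)
  rw [ENNReal.ofReal_mul (by positivity),
    ENNReal.ofReal_sum_of_nonneg (fun _ _ => by positivity),
    ENNReal.ofReal_sum_of_nonneg (fun _ _ => by positivity)] at h
  simpa only [← ENNReal.ofReal_rpow_of_nonneg (norm_nonneg _) ENNReal.toReal_nonneg,
    ofReal_norm_eq_enorm] using h

lemma Lp_enorm_rpow {p : ℝ≥0∞} [Fact (1 ≤ p)] (hp : p ≠ ∞)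
    {Ω' : Type*} [MeasurableSpace Ω'] {ν : Measure Ω'} (f : Lp ℂ p ν) :
    ‖f‖ₑ ^ p.toReal = ∫⁻ x, ‖f x‖ₑ ^ p.toReal ∂ν := by
  have hp0 : p ≠ 0 := (zero_lt_one.trans_le (Fact.out : 1 ≤ p)).ne'
  have hq : 0 < p.toReal := ENNReal.toReal_pos hp0 hp
  rw [Lp.enorm_def, eLpNorm_eq_lintegral_rpow_enorm_toReal hp0 hp, ← ENNReal.rpow_mul,
    one_div, inv_mul_cancel₀ hq.ne', ENNReal.rpow_one]

lemma Lp_coeFn_sum_smul {p : ℝ≥0∞} [Fact (1 ≤ p)]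
    {Ω' : Type*} [MeasurableSpace Ω'] {ν : Measure Ω'} (s : Finset ℕ) (a : ℕ → ℂ)
    (g : ℕ → Lp ℂ p ν) :
    ∀ᵐ x ∂ν, (∑ k ∈ s, a k • g k : Lp ℂ p ν) x = ∑ k ∈ s, a k * g k x := by
  induction s using Finset.induction_on with
  | empty =>
    filter_upwards [Lp.coeFn_zero ℂ p ν] with x hx
    simpa using hx
  | insert i s hi ih =>
    rw [Finset.sum_insert hi]
    filter_upwards [ih, Lp.coeFn_add (a i • g i) (∑ k ∈ s, a k • g k),
      Lp.coeFn_smul (a i) (g i)] with x h1 h2 h3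
    rw [h2, Finset.sum_insert hi, Pi.add_apply, h3, h1, Pi.smul_apply, smul_eq_mul]

lemma isometry_pow_norm {E : Type*} [NormedAddCommGroup E] [NormedSpace ℂ E]
    (U : E →L[ℂ] E) (hU : Isometry U) (k : ℕ) (f : E) : ‖(U ^ k) f‖ₑ = ‖f‖ₑ := by
  induction k with
  | zero => simp
  | succ k ih =>
    rw [pow_succ', ContinuousLinearMap.mul_apply, ← ih, ← edist_zero_right, ← edist_zero_right]
    have := hU.edist_eq ((U ^ k) f) 0
    rwa [map_zero] at this

lemma isometry_transfer {p : ℝ≥0∞} [Fact (1 ≤ p)] (hp : p ≠ ∞)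
    {Ω' : Type*} [MeasurableSpace Ω'] {ν : Measure Ω'}
    (U : Lp ℂ p ν →L[ℂ] Lp ℂ p ν) (hU : Isometry U)
    (S : lp (fun _ : ℕ => ℂ) p →L[ℂ] lp (fun _ : ℕ => ℂ) p)
    (hS : ∀ (x : lp (fun _ : ℕ => ℂ) p) (j : ℕ),
      (S x : ∀ _ : ℕ, ℂ) j = if j = 0 then 0 else (x : ∀ _ : ℕ, ℂ) (j - 1))
    (P : Polynomial ℂ) (f : Lp ℂ p ν) (N : ℕ) :
    (N : ℝ≥0∞) * ‖Polynomial.aeval U P f‖ₑ ^ p.toReal ≤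
      ‖Polynomial.aeval S P‖ₑ ^ p.toReal *
        (((N + P.natDegree + 1 : ℕ) : ℝ≥0∞) * ‖f‖ₑ ^ p.toReal) := by
  have hmeas : ∀ g : Lp ℂ p ν, AEMeasurable (fun x => ‖g x‖ₑ ^ p.toReal) ν := fun g =>
    (Lp.aestronglyMeasurable g).enorm.pow_const _
  have hexp : ∀ j : ℕ, (U ^ j) (Polynomial.aeval U P f) =
      ∑ k ∈ Finset.range (P.natDegree + 1), P.coeff k • (U ^ (j + k)) f := by
    intro j
    rw [Polynomial.aeval_eq_sum_range]
    simp only [ContinuousLinearMap.sum_apply, ContinuousLinearMap.smul_apply, map_sum, map_smul,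
      pow_add, ContinuousLinearMap.mul_apply]
  calc (N : ℝ≥0∞) * ‖Polynomial.aeval U P f‖ₑ ^ p.toReal
      = ∑ j ∈ Finset.range N, ‖(U ^ j) (Polynomial.aeval U P f)‖ₑ ^ p.toReal := by
        simp only [isometry_pow_norm U hU, Finset.sum_const, Finset.card_range, nsmul_eq_mul]
    _ = ∑ j ∈ Finset.range N,
          ∫⁻ x, ‖((U ^ j) (Polynomial.aeval U P f) : Lp ℂ p ν) x‖ₑ ^ p.toReal ∂ν := by
        simp only [Lp_enorm_rpow hp]
    _ = ∫⁻ x, ∑ j ∈ Finset.range N,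
          ‖((U ^ j) (Polynomial.aeval U P f) : Lp ℂ p ν) x‖ₑ ^ p.toReal ∂ν := by
        rw [lintegral_finsetSum' _ (fun j _ => hmeas _)]
    _ ≤ ∫⁻ x, ‖Polynomial.aeval S P‖ₑ ^ p.toReal *
        ∑ m ∈ Finset.range (N + P.natDegree + 1), ‖((U ^ m) f : Lp ℂ p ν) x‖ₑ ^ p.toReal ∂ν := by
        apply lintegral_mono_ae
        have hall : ∀ᵐ x ∂ν, ∀ j : ℕ, ((U ^ j) (Polynomial.aeval U P f) : Lp ℂ p ν) x =
            ∑ k ∈ Finset.range (P.natDegree + 1),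
              P.coeff k * ((U ^ (j + k)) f : Lp ℂ p ν) x := by
          rw [ae_all_iff]
          intro j
          rw [hexp]
          exact Lp_coeFn_sum_smul _ _ _
        filter_upwards [hall] with x hx
        simp only [hx]
        exact shift_finite_bound_enorm hp S hS P (fun m => ((U ^ m) f : Lp ℂ p ν) x) N
    _ = ‖Polynomial.aeval S P‖ₑ ^ p.toReal * ∑ m ∈ Finset.range (N + P.natDegree + 1),
          ∫⁻ x, ‖((U ^ m) f : Lp ℂ p ν) x‖ₑ ^ p.toReal ∂ν := by
        rw [lintegral_const_mul'', lintegral_finsetSum' _ (fun j _ => hmeas _)]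
        exact Finset.aemeasurable_fun_sum _ (fun j _ => hmeas _)
    _ = _ := by
        simp only [← Lp_enorm_rpow hp, isometry_pow_norm U hU, Finset.sum_const,
          Finset.card_range, nsmul_eq_mul]

lemma isometry_bound {p : ℝ≥0∞} [Fact (1 ≤ p)] (hp : p ≠ ∞)
    {Ω' : Type*} [MeasurableSpace Ω'] {ν : Measure Ω'}
    (U : Lp ℂ p ν →L[ℂ] Lp ℂ p ν) (hU : Isometry U)
    (S : lp (fun _ : ℕ => ℂ) p →L[ℂ] lp (fun _ : ℕ => ℂ) p)
    (hS : ∀ (x : lp (fun _ : ℕ => ℂ) p) (j : ℕ),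
      (S x : ∀ _ : ℕ, ℂ) j = if j = 0 then 0 else (x : ∀ _ : ℕ, ℂ) (j - 1))
    (P : Polynomial ℂ) (f : Lp ℂ p ν) :
    ‖Polynomial.aeval U P f‖ ≤ ‖Polynomial.aeval S P‖ * ‖f‖ := by
  have hq : 0 < p.toReal :=
    ENNReal.toReal_pos (zero_lt_one.trans_le Fact.out).ne' hp
  have key : ∀ N : ℕ, (N : ℝ) * ‖Polynomial.aeval U P f‖ ^ p.toReal ≤
      ‖Polynomial.aeval S P‖ ^ p.toReal *
        (((N + P.natDegree + 1 : ℕ) : ℝ) * ‖f‖ ^ p.toReal) := by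
    intro N
    have h := ENNReal.toReal_mono (by finiteness) (isometry_transfer hp U hU S hS P f N)
    simpa only [ENNReal.toReal_mul, ← ENNReal.toReal_rpow, toReal_enorm,
      ENNReal.toReal_natCast] using h
  rw [← Real.rpow_le_rpow_iff (norm_nonneg _) (by positivity) hq,
    Real.mul_rpow (norm_nonneg _) (norm_nonneg _)]
  generalize ‖Polynomial.aeval U P f‖ ^ p.toReal = A at *
  generalize ‖Polynomial.aeval S P‖ ^ p.toReal = C at *
  generalize ‖f‖ ^ p.toReal = B at *
  by_contra! hlt
  obtain ⟨N, hN⟩ := exists_nat_gt (C * B * (P.natDegree + 1) / (A - C * B))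
  rw [div_lt_iff₀ (by linarith)] at hN
  have := key N
  push_cast at this
  nlinarith

/-- Let `1 ≤ p < ∞`, let `(Ω, μ)` and `(Ω', ν)` be σ-finite measure
spaces, and let `T : L^p(μ) → L^p(μ)` be a bounded linear map admitting a dilation
`T^k = Q ∘ U^k ∘ J` (`k ≥ 0`) with `J : L^p(μ) → L^p(ν)` and `U : L^p(ν) → L^p(ν)` linear
isometries and `Q : L^p(ν) → L^p(μ)` a contraction.  Then for every complex polynomial
`P`, `‖P(T)‖ ≤ ‖P(S)‖_{ℓ^p(ℕ)→ℓ^p(ℕ)}`, where `S` is the right shift on `ℓ^p(ℕ)`. -/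
theorem dilation_matsaev_property (p : ℝ≥0∞) [Fact (1 ≤ p)] (hp : p ≠ ∞)
    (Ω : Type*) [MeasurableSpace Ω] (μ : Measure Ω) [SigmaFinite μ]
    (Ω' : Type*) [MeasurableSpace Ω'] (ν : Measure Ω') [SigmaFinite ν]
    (T : Lp ℂ p μ →L[ℂ] Lp ℂ p μ)
    (J : Lp ℂ p μ →L[ℂ] Lp ℂ p ν) (hJ : Isometry J)
    (U : Lp ℂ p ν →L[ℂ] Lp ℂ p ν) (hU : Isometry U)
    (Q : Lp ℂ p ν →L[ℂ] Lp ℂ p μ) (hQ : ‖Q‖ ≤ 1)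
    (hdil : ∀ k : ℕ, T ^ k = (Q.comp (U ^ k)).comp J)
    (S : lp (fun _ : ℕ => ℂ) p →L[ℂ] lp (fun _ : ℕ => ℂ) p)
    (hS : ∀ (x : lp (fun _ : ℕ => ℂ) p) (j : ℕ),
      (S x : ∀ _ : ℕ, ℂ) j = if j = 0 then 0 else (x : ∀ _ : ℕ, ℂ) (j - 1))
    (P : Polynomial ℂ) :
    ‖Polynomial.aeval T P‖ ≤ ‖Polynomial.aeval S P‖ := by
  refine ContinuousLinearMap.opNorm_le_bound _ (norm_nonneg _) fun f => ?_
  have hPT : Polynomial.aeval T P f = Q (Polynomial.aeval U P (J f)) := by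
    rw [Polynomial.aeval_eq_sum_range, Polynomial.aeval_eq_sum_range]
    simp only [ContinuousLinearMap.sum_apply, ContinuousLinearMap.smul_apply, map_sum, map_smul,
      hdil, ContinuousLinearMap.comp_apply]
  have hJf : ‖J f‖ = ‖f‖ := by
    have := hJ.dist_eq f 0
    rwa [map_zero, dist_zero_right, dist_zero_right] at this
  rw [hPT]
  calc ‖Q (Polynomial.aeval U P (J f))‖ ≤ 1 * ‖Polynomial.aeval U P (J f)‖ :=
        Q.le_of_opNorm_le hQ _
    _ = ‖Polynomial.aeval U P (J f)‖ := one_mul _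
    _ ≤ ‖Polynomial.aeval S P‖ * ‖J f‖ := isometry_bound hp U hU S hS P (J f)
    _ = ‖Polynomial.aeval S P‖ * ‖f‖ := by rw [hJf]
end
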